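/- arXiv:2312.06260 — 6 statements merged into one kernel-verified Lean document; each statement's English description precedes it below -/
import Mathlib

section
/- The temporal graph C on four vertices a,b,c,d with edges ab, bc, cd, da and time labels λ(ab)={1}, λ(bc)={2}, λ(cd)={1}, λ(da)={2} is temporally connected (in the non-strict setting), but it admits no temporal spanning tree: every temporal subgraph of C whose footprint is a spanning tree of {a,b,c,d} is not temporally connected. -/
namespace TemporalPaper

/-- A temporal graph on vertex set `V`: an undirected labeling assigning to each
(unordered) pair of vertices a finite set of rational time labels; a pair is an
edge of the graph iff its label set is nonempty. -/
structure TemporalGraph (V : Type*) where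
  label : V → V → Finset ℚ
  symm : ∀ u v, label u v = label v u
  loopless : ∀ v, label v v = ∅

namespace TemporalGraph

variable {V : Type*}

/-- The footprint (static underlying graph) of a temporal graph. -/
def footprint (G : TemporalGraph V) : SimpleGraph V where
  Adj u v := (G.label u v).Nonempty
  symm := ⟨fun u v h => by rwa [G.symm]⟩
  loopless := ⟨fun v h => by rw [G.loopless] at h; exact Finset.not_nonempty_empty h⟩

/-- The snapshot of a temporal graph at time `t`. -/
def snapshot (G : TemporalGraph V) (t : ℚ) : SimpleGraph V where
  Adj u v := t ∈ G.label u v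
  symm := ⟨fun u v h => by rwa [G.symm]⟩
  loopless := ⟨fun v h => by rw [G.loopless] at h; exact absurd h (Finset.notMem_empty t)⟩

/-- `G.IsTJ r p ts` : the list of vertices `p` together with the list of times `ts`
(one per consecutive pair of vertices of `p`) forms a temporal walk, i.e. each time
belongs to the labels of the corresponding edge, and consecutive times satisfy `r`
(`r = (· ≤ ·)` for non-strict temporal walks, `r = (· < ·)` for strict ones). -/
inductive IsTJ (G : TemporalGraph V) (r : ℚ → ℚ → Prop) : List V → List ℚ → Prop
  | single (v : V) : IsTJ G r [v] []
  | cons {u v : V} {p : List V} {t : ℚ} {ts : List ℚ} :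
      t ∈ G.label u v → IsTJ G r (v :: p) ts →
      (∀ t' ∈ ts.head?, r t t') → IsTJ G r (u :: v :: p) (t :: ts)

/-- A temporal path from `u` to `v` with underlying (vertex-)path `p` and times `ts`. -/
def TPath (G : TemporalGraph V) (r : ℚ → ℚ → Prop) (u v : V)
    (p : List V) (ts : List ℚ) : Prop :=
  G.IsTJ r p ts ∧ p.Nodup ∧ p.head? = some u ∧ p.getLast? = some v

/-- Temporal reachability. -/
def Reach (G : TemporalGraph V) (r : ℚ → ℚ → Prop) (u v : V) : Prop :=
  ∃ p ts, G.TPath r u v p ts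

def TemporallyConnectedRel (G : TemporalGraph V) (r : ℚ → ℚ → Prop) : Prop :=
  ∀ u v : V, u ≠ v → G.Reach r u v

/-- Temporal connectivity (non-strict setting). -/
def TemporallyConnected (G : TemporalGraph V) : Prop :=
  G.TemporallyConnectedRel (· ≤ ·)

/-- A bidirectional temporal path (bi-path) between `u` and `v` on the underlying
path `p` (from `u` to `v`): a temporal path in each direction along `p`. -/
def BiPath (G : TemporalGraph V) (r : ℚ → ℚ → Prop) (u v : V)
    (p : List V) (ts₁ ts₂ : List ℚ) : Prop :=
  G.TPath r u v p ts₁ ∧ G.TPath r v u p.reverse ts₂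

def BiConnectedRel (G : TemporalGraph V) (r : ℚ → ℚ → Prop) : Prop :=
  ∀ u v : V, u ≠ v → ∃ p ts₁ ts₂, G.BiPath r u v p ts₁ ts₂

/-- Bidirectional temporal connectivity (non-strict setting). -/
def BiConnected (G : TemporalGraph V) : Prop := G.BiConnectedRel (· ≤ ·)

/-- `H` is a temporal subgraph of `G` (on the same vertex set). -/
def IsSubgraph (H G : TemporalGraph V) : Prop := ∀ u v, H.label u v ⊆ G.label u v

/-- A temporal spanner of `G`: a temporally connected temporal subgraph on all of `V`. -/
def IsSpanner (H G : TemporalGraph V) : Prop := H.IsSubgraph G ∧ H.TemporallyConnected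

/-- A temporal spanning tree of `G`: a temporal spanner whose footprint is a tree. -/
def IsSpanningTree (H G : TemporalGraph V) : Prop := H.IsSpanner G ∧ H.footprint.IsTree

/-- A bidirectional temporal spanner (bi-spanner) of `G`. -/
def IsBiSpanner (H G : TemporalGraph V) : Prop := H.IsSpanner G ∧ H.BiConnected

/-- A temporal graph is simple if every edge has exactly one time label,
i.e. every label set has at most one element (edges have nonempty label sets). -/
def Simple (G : TemporalGraph V) : Prop := ∀ u v, (G.label u v).card ≤ 1

/-- A temporal graph is proper if any two (distinct) edges sharing a vertex have
disjoint label sets. -/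
def Proper (G : TemporalGraph V) : Prop :=
  ∀ u v w : V, v ≠ w → Disjoint (G.label u v) (G.label u w)

def Happy (G : TemporalGraph V) : Prop := G.Simple ∧ G.Proper

/-- `u` can reach `v` by a (non-strict) temporal path arriving at time at most `t`. -/
def ArrivesBy (G : TemporalGraph V) (u v : V) (t : ℚ) : Prop :=
  ∃ p ts, G.TPath (· ≤ ·) u v p ts ∧ ∀ t' ∈ ts.getLast?, t' ≤ t

/-- `u` can reach `v` by a (non-strict) temporal path departing at time at least `t`. -/
def DepartsAfter (G : TemporalGraph V) (u v : V) (t : ℚ) : Prop :=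
  ∃ p ts, G.TPath (· ≤ ·) u v p ts ∧ ∀ t' ∈ ts.head?, t ≤ t'

/-- A pivot: some time `t` such that every other vertex reaches `x` by time `t`
and `x` reaches every other vertex departing not earlier than `t`. -/
def IsPivot (G : TemporalGraph V) (x : V) : Prop :=
  ∃ t : ℚ, ∀ u : V, u ≠ x → G.ArrivesBy u x t ∧ G.DepartsAfter x u t

/-- Deleting the (undirected) edge `ab` from a temporal graph. -/
def deleteEdge [DecidableEq V] (G : TemporalGraph V) (a b : V) : TemporalGraph V where
  label u v := if (u = a ∧ v = b) ∨ (u = b ∧ v = a) then ∅ else G.label u v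
  symm := by
    intro u v
    have h : ((u = a ∧ v = b) ∨ (u = b ∧ v = a)) ↔ ((v = a ∧ u = b) ∨ (v = b ∧ u = a)) := by
      tauto
    rw [G.symm, if_congr h rfl rfl]
  loopless := by
    intro v
    split_ifs with h
    · rfl
    · exact G.loopless v

end TemporalGraph

end TemporalPaper

namespace TemporalPaper

open TemporalGraph

/-- One orientation of the labeling of the 4-cycle `a b c d` (with `a=0, b=1, c=2, d=3`):
`λ(ab)={1}, λ(bc)={2}, λ(cd)={1}, λ(da)={2}`. -/
def coreC4 : Fin 4 → Fin 4 → Finset ℚ := fun u v =>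
  if u = 0 ∧ v = 1 then {1}
  else if u = 1 ∧ v = 2 then {2}
  else if u = 2 ∧ v = 3 then {1}
  else if u = 3 ∧ v = 0 then {2}
  else ∅

/-- The temporal graph of Figure 1: the 4-cycle `a b c d` with labels
`λ(ab)={1}, λ(bc)={2}, λ(cd)={1}, λ(da)={2}`. -/
def C4 : TemporalGraph (Fin 4) where
  label u v := coreC4 u v ∪ coreC4 v u
  symm := fun u v => Finset.union_comm _ _
  loopless := fun v => by fin_cases v <;> rfl

namespace TemporalGraph

variable {V : Type*} {G : TemporalGraph V} {r : ℚ → ℚ → Prop}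

theorem reach_of_mem_label {u v : V} {t : ℚ} (h : t ∈ G.label u v) (huv : u ≠ v) :
    G.Reach r u v :=
  ⟨[u, v], [t], .cons h (.single v) (by simp), by simpa, by simp, by simp⟩

theorem reach_of_mem_label_of_mem_label {u v w : V} {s t : ℚ} (hs : s ∈ G.label u v)
    (ht : t ∈ G.label v w) (hst : r s t) (huv : u ≠ v) (hvw : v ≠ w) (huw : u ≠ w) :
    G.Reach r u w :=
  ⟨[u, v, w], [s, t], .cons hs (.cons ht (.single w) (by simp)) (by simpa),
    by simp [huv, hvw, huw], by simp, by simp⟩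

/-- A property of (vertex, time) states that is preserved by every available contact holds at the
end of every temporal walk. -/
theorem IsTJ.invariant {P : V → ℚ → Prop}
    (hP : ∀ u v s t, P u s → t ∈ G.label u v → r s t → P v t)
    {p : List V} {ts : List ℚ} (h : G.IsTJ r p ts) :
    ∀ u v s, p.head? = some u → p.getLast? = some v → P u s → (∀ t ∈ ts.head?, r s t) →
      ∃ t, P v t := by
  induction h with
  | single w =>
    intro u v s hu hv hs _
    simp only [List.head?_cons, List.getLast?_singleton, Option.some.injEq] at hu hv
    subst hu hv
    exact ⟨s, hs⟩
  | @cons x y p t ts ht _ htt ih =>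
    intro u v s hu hv hs hst
    simp only [List.head?_cons, Option.some.injEq] at hu
    subst hu
    exact ih y v t rfl (by simpa using hv) (hP x y s t hs ht (hst t rfl)) htt

theorem not_temporallyConnected_of_invariant (P : V → ℚ → Prop)
    (hP : ∀ u v s t, P u s → t ∈ G.label u v → s ≤ t → P v t) {u v : V}
    (hu : ∀ t, P u t) (hv : ∀ t, ¬ P v t) : ¬ G.TemporallyConnected := by
  intro h
  have huv : u ≠ v := by
    rintro rfl
    exact hv 0 (hu 0)
  obtain ⟨p, ts, hp, -, hpu, hpv⟩ := h u v huv
  obtain ⟨t, ht⟩ := hp.invariant hP u v (ts.head?.getD 0) hpu hpv (hu _)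
    (fun t ht => by rw [Option.mem_def.1 ht]; rfl)
  exact hv t ht

end TemporalGraph

theorem mem_label_C4 {u v : Fin 4} {t : ℚ} : t ∈ C4.label u v ↔
    (t = 1 ∧ (u = 0 ∧ v = 1 ∨ u = 1 ∧ v = 0 ∨ u = 2 ∧ v = 3 ∨ u = 3 ∧ v = 2)) ∨
    (t = 2 ∧ (u = 1 ∧ v = 2 ∨ u = 2 ∧ v = 1 ∨ u = 3 ∧ v = 0 ∨ u = 0 ∧ v = 3)) := by
  fin_cases u <;> fin_cases v <;> simp [C4, coreC4]

theorem temporallyConnected_C4 : C4.TemporallyConnected := by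
  have one {u v : Fin 4} (t : ℚ) (h : t ∈ C4.label u v) (huv : u ≠ v) :
      C4.Reach (· ≤ ·) u v := reach_of_mem_label h huv
  have two {u w : Fin 4} (v : Fin 4) (h : (1 : ℚ) ∈ C4.label u v) (h' : (2 : ℚ) ∈ C4.label v w)
      (huv : u ≠ v) (hvw : v ≠ w) (huw : u ≠ w) : C4.Reach (· ≤ ·) u w :=
    reach_of_mem_label_of_mem_label h h' (by norm_num) huv hvw huw
  intro u v huv
  fin_cases u <;> fin_cases v <;> first
    | exact absurd rfl huv
    | (apply one 1 <;> (simp [mem_label_C4]; done))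
    | (apply one 2 <;> (simp [mem_label_C4]; done))
    | (apply two 0 <;> (simp [mem_label_C4]; done))
    | (apply two 1 <;> (simp [mem_label_C4]; done))
    | (apply two 2 <;> (simp [mem_label_C4]; done))
    | (apply two 3 <;> simp [mem_label_C4])

theorem not_isAcyclic_of_four_cycle {G : SimpleGraph (Fin 4)} (h01 : G.Adj 0 1) (h12 : G.Adj 1 2)
    (h23 : G.Adj 2 3) (h30 : G.Adj 3 0) : ¬ G.IsAcyclic := by
  intro h
  let p : G.Walk 0 2 := .cons h01 (.cons h12 .nil)
  let q : G.Walk 0 2 := .cons h30.symm (.cons h23.symm .nil)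
  have hp : p.IsPath := by simp [p, SimpleGraph.Walk.isPath_def]
  have hq : q.IsPath := by simp [q, SimpleGraph.Walk.isPath_def]
  have hpq := congrArg (fun w : G.Path 0 2 => w.1.support)
    ((h.subsingleton_path 0 2).elim ⟨p, hp⟩ ⟨q, hq⟩)
  simp [p, q] at hpq

theorem not_temporallyConnected_of_label_eq_empty {H : TemporalGraph (Fin 4)}
    (hH : H.IsSubgraph C4)
    (h : H.label 0 1 = ∅ ∨ H.label 1 2 = ∅ ∨ H.label 2 3 = ∅ ∨ H.label 3 0 = ∅) :
    ¬ H.TemporallyConnected := by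
  have key (P : Fin 4 → ℚ → Prop) {a b u v : Fin 4} (hab : H.label a b = ∅)
      (hP : ∀ x y s t, P x s → t ∈ C4.label x y → ¬ (x = a ∧ y = b) → ¬ (x = b ∧ y = a) →
        s ≤ t → P y t)
      (hu : ∀ t, P u t) (hv : ∀ t, ¬ P v t) : ¬ H.TemporallyConnected := by
    refine not_temporallyConnected_of_invariant P (fun x y s t hx ht hst => ?_) hu hv
    refine hP x y s t hx (hH x y ht) ?_ ?_ hst
    · rintro ⟨rfl, rfl⟩
      simp [hab] at ht
    · rintro ⟨rfl, rfl⟩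
      simp [H.symm x y, hab] at ht
  rcases h with h | h | h | h
  · refine key (fun x s => x = 1 ∨ x = 2 ∧ s = 2) (u := 1) (v := 0) h ?_ (by simp) (by simp)
    intro x y s t hx ht
    rw [mem_label_C4] at ht
    grind
  · refine key (fun x s => x = 3 ∨ x = 2 ∨ x = 0 ∧ s = 2) (u := 3) (v := 1) h ?_ (by simp)
      (by simp)
    intro x y s t hx ht
    rw [mem_label_C4] at ht
    grind
  · refine key (fun x s => x = 3 ∨ x = 0 ∧ s = 2) (u := 3) (v := 2) h ?_ (by simp) (by simp)
    intro x y s t hx ht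
    rw [mem_label_C4] at ht
    grind
  · refine key (fun x s => x = 2 ∨ x = 3 ∨ x = 1 ∧ s = 2) (u := 2) (v := 0) h ?_ (by simp)
      (by simp)
    intro x y s t hx ht
    rw [mem_label_C4] at ht
    grind

/-- `C4` is temporally connected (non-strict setting), but every temporal
subgraph of `C4` whose footprint is a (spanning) tree is not temporally connected;
in particular `C4` admits no temporal spanning tree. -/
theorem stmt0 :
    C4.TemporallyConnected ∧
    (∀ H : TemporalGraph (Fin 4), H.IsSubgraph C4 → H.footprint.IsTree →
      ¬ H.TemporallyConnected) ∧
    ¬ ∃ H : TemporalGraph (Fin 4), H.IsSpanningTree C4 := by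
  have main (H : TemporalGraph (Fin 4)) (hH : H.IsSubgraph C4) (hT : H.footprint.IsTree) :
      ¬ H.TemporallyConnected := by
    refine not_temporallyConnected_of_label_eq_empty hH ?_
    by_contra! h
    exact not_isAcyclic_of_four_cycle (G := H.footprint) h.1 h.2.1 h.2.2.1 h.2.2.2 hT.isAcyclic
  refine ⟨temporallyConnected_C4, main, ?_⟩
  rintro ⟨H, ⟨hH, hC⟩, hT⟩
  exact main H hH hT hC

end TemporalPaper
end

section
/- The temporal graph H on six vertices a,b,c,d,e,f with edges and labels λ(ab)={1,9}, λ(bc)={2,8}, λ(cd)={3,7}, λ(de)={6}, λ(eb)={5,10}, λ(bf)={4,11} is temporally connected, every pair of distinct vertices of H is joined by a bi-path, and d is a pivot of H; yet H admits no temporal spanning tree. -/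
namespace TemporalPaper

open TemporalGraph

/-- One orientation of the labeling of the graph of Figure 2, with
`a=0, b=1, c=2, d=3, e=4, f=5`:
`λ(ab)={1,9}, λ(bc)={2,8}, λ(cd)={3,7}, λ(de)={6}, λ(eb)={5,10}, λ(bf)={4,11}`. -/
def coreG6 : Fin 6 → Fin 6 → Finset ℚ := fun u v =>
  if u = 0 ∧ v = 1 then {1, 9}
  else if u = 1 ∧ v = 2 then {2, 8}
  else if u = 2 ∧ v = 3 then {3, 7}
  else if u = 3 ∧ v = 4 then {6}
  else if u = 4 ∧ v = 1 then {5, 10}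
  else if u = 1 ∧ v = 5 then {4, 11}
  else ∅

/-- The temporal graph of Figure 2. -/
def G6 : TemporalGraph (Fin 6) where
  label u v := coreG6 u v ∪ coreG6 v u
  symm := fun u v => Finset.union_comm _ _
  loopless := fun v => by fin_cases v <;> rfl

namespace TemporalGraph

variable {V : Type*}

@[simp]
theorem isTJ_single (G : TemporalGraph V) (r : ℚ → ℚ → Prop) (v : V) : G.IsTJ r [v] [] :=
  .single v

@[simp]
theorem isTJ_cons_iff (G : TemporalGraph V) (r : ℚ → ℚ → Prop) (u v : V) (p : List V)
    (t : ℚ) (ts : List ℚ) :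
    G.IsTJ r (u :: v :: p) (t :: ts) ↔
      t ∈ G.label u v ∧ G.IsTJ r (v :: p) ts ∧ ∀ t' ∈ ts.head?, r t t' :=
  ⟨fun | .cons h₁ h₂ h₃ => ⟨h₁, h₂, h₃⟩, fun ⟨h₁, h₂, h₃⟩ => .cons h₁ h₂ h₃⟩

theorem IsTJ.mono {H G : TemporalGraph V} (hHG : H.IsSubgraph G) {r : ℚ → ℚ → Prop}
    {p : List V} {ts : List ℚ} (h : H.IsTJ r p ts) : G.IsTJ r p ts := by
  induction h with
  | single v => exact .single v
  | cons ht _ hr ih => exact .cons (hHG _ _ ht) ih hr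

theorem Reach.mono {H G : TemporalGraph V} (hHG : H.IsSubgraph G) {r : ℚ → ℚ → Prop}
    {u v : V} : H.Reach r u v → G.Reach r u v
  | ⟨p, ts, h, hp⟩ => ⟨p, ts, h.mono hHG, hp⟩

theorem BiPath.symm {G : TemporalGraph V} {r : ℚ → ℚ → Prop} {u v : V} {p : List V}
    {ts₁ ts₂ : List ℚ} (h : G.BiPath r u v p ts₁ ts₂) : G.BiPath r v u p.reverse ts₂ ts₁ :=
  ⟨h.2, by simpa using h.1⟩

theorem BiConnected.temporallyConnected {G : TemporalGraph V} (h : G.BiConnected) :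
    G.TemporallyConnected := fun u v huv =>
  let ⟨p, ts, _, hp, _⟩ := h u v huv
  ⟨p, ts, hp⟩

theorem biConnected_of_lt [LinearOrder V] {G : TemporalGraph V}
    (h : ∀ u v, u < v → ∃ p ts₁ ts₂, G.BiPath (· ≤ ·) u v p ts₁ ts₂) : G.BiConnected := by
  intro u v huv
  rcases lt_or_gt_of_ne huv with h' | h'
  · exact h u v h'
  · obtain ⟨p, ts₁, ts₂, hp⟩ := h v u h'
    exact ⟨_, _, _, hp.symm⟩

/-- A lower bound on earliest arrival times that is finite at the start of a temporal walk is
finite at its end. -/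
theorem IsTJ.arrival_ne_top {G : TemporalGraph V} {f : V → WithTop ℚ}
    (hf : ∀ u v, ∀ t ∈ G.label u v, f u ≤ t → f v ≤ t) {p : List V} {ts : List ℚ}
    (h : G.IsTJ (· ≤ ·) p ts) {u v : V} (hu : p.head? = some u) (hv : p.getLast? = some v)
    (hu_top : f u ≠ ⊤) (hts : ∀ t ∈ ts.head?, f u ≤ t) : f v ≠ ⊤ := by
  induction h generalizing u with
  | single w => simp_all
  | @cons x y p t ts ht _ hr ih =>
    obtain rfl : x = u := by simpa using hu
    have hy : f y ≤ t := hf x y t ht (hts t (by simp))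
    refine ih (by simp) (by simpa using hv) (ne_top_of_le_ne_top WithTop.coe_ne_top hy) ?_
    exact fun t' ht' => hy.trans (WithTop.coe_le_coe.2 (hr t' ht'))

theorem not_reach_of_arrival {G : TemporalGraph V} {u v : V} (f : V → WithTop ℚ)
    (hf : ∀ u v, ∀ t ∈ G.label u v, f u ≤ t → f v ≤ t) (hu_top : f u ≠ ⊤)
    (hu : ∀ w, ∀ t ∈ G.label u w, f u ≤ t) (hv : f v = ⊤) : ¬ G.Reach (· ≤ ·) u v := by
  rintro ⟨p, ts, h, -, hp, hl⟩
  refine h.arrival_ne_top hf hp hl hu_top ?_ hv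
  cases h with
  | single => simp
  | cons ht =>
    obtain rfl := by simpa using hp
    simpa using hu _ _ ht

theorem IsSubgraph.deleteEdge [DecidableEq V] {H G : TemporalGraph V} (hHG : H.IsSubgraph G)
    {a b : V} (hab : ¬ H.footprint.Adj a b) : H.IsSubgraph (G.deleteEdge a b) := by
  have h : H.label a b = ∅ := Finset.not_nonempty_iff_eq_empty.1 hab
  intro u v
  simp only [TemporalGraph.deleteEdge]
  split_ifs with huv
  · rcases huv with ⟨rfl, rfl⟩ | ⟨rfl, rfl⟩
    · exact h.subset
    · exact (H.symm _ _).trans h |>.subset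
  · exact hHG u v

end TemporalGraph

theorem not_isAcyclic_of_square {V : Type*} {G : SimpleGraph V} {a b c d : V} (hac : a ≠ c)
    (hbd : b ≠ d) (hab : G.Adj a b) (hbc : G.Adj b c) (hcd : G.Adj c d) (hda : G.Adj d a) :
    ¬ G.IsAcyclic := by
  intro h
  let p : G.Path a c := ⟨.cons hab (.cons hbc .nil), by simp [hab.ne, hbc.ne, hac]⟩
  let q : G.Path a c := ⟨.cons hda.symm (.cons hcd.symm .nil), by
    simp [hda.ne', hcd.ne', hac]⟩
  have hpq : p.1.support = q.1.support := by rw [(h.subsingleton_path a c).elim p q]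
  simp [p, q, hbd] at hpq

theorem G6_biConnected : G6.BiConnected := by
  refine biConnected_of_lt fun u v huv => ?_
  fin_cases u <;> fin_cases v <;> first | exact absurd huv (by decide) | skip
  · refine ⟨[0, 1], [1], [1], ?_⟩
    simp [BiPath, TPath, G6, coreG6]
  · refine ⟨[0, 1, 2], [1, 2], [8, 9], ?_⟩
    simp [BiPath, TPath, G6, coreG6]
    norm_num
  · refine ⟨[0, 1, 2, 3], [1, 2, 3], [7, 8, 9], ?_⟩
    simp [BiPath, TPath, G6, coreG6]
    norm_num
  · refine ⟨[0, 1, 4], [1, 5], [5, 9], ?_⟩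
    simp [BiPath, TPath, G6, coreG6]
    norm_num
  · refine ⟨[0, 1, 5], [1, 4], [4, 9], ?_⟩
    simp [BiPath, TPath, G6, coreG6]
    norm_num
  · refine ⟨[1, 2], [2], [2], ?_⟩
    simp [BiPath, TPath, G6, coreG6]
  · refine ⟨[1, 2, 3], [2, 3], [7, 8], ?_⟩
    simp [BiPath, TPath, G6, coreG6]
    norm_num
  · refine ⟨[1, 4], [5], [5], ?_⟩
    simp [BiPath, TPath, G6, coreG6]
  · refine ⟨[1, 5], [4], [4], ?_⟩
    simp [BiPath, TPath, G6, coreG6]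
  · refine ⟨[2, 3], [3], [3], ?_⟩
    simp [BiPath, TPath, G6, coreG6]
  · refine ⟨[2, 1, 4], [2, 5], [5, 8], ?_⟩
    simp [BiPath, TPath, G6, coreG6]
    norm_num
  · refine ⟨[2, 1, 5], [2, 4], [4, 8], ?_⟩
    simp [BiPath, TPath, G6, coreG6]
    norm_num
  · refine ⟨[3, 4], [6], [6], ?_⟩
    simp [BiPath, TPath, G6, coreG6]
  · refine ⟨[3, 4, 1, 5], [6, 10, 11], [4, 5, 6], ?_⟩
    simp [BiPath, TPath, G6, coreG6]
    norm_num
  · refine ⟨[4, 1, 5], [5, 11], [4, 5], ?_⟩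
    simp [BiPath, TPath, G6, coreG6]
    norm_num

theorem G6_isPivot : G6.IsPivot 3 := by
  refine ⟨6, fun u hu => ?_⟩
  fin_cases u <;> first | exact absurd rfl hu | skip
  · refine ⟨⟨[0, 1, 2, 3], [1, 2, 3], ?_⟩, [3, 2, 1, 0], [7, 8, 9], ?_⟩ <;>
      simp [TPath, G6, coreG6] <;> norm_num
  · refine ⟨⟨[1, 2, 3], [2, 3], ?_⟩, [3, 2, 1], [7, 8], ?_⟩ <;>
      simp [TPath, G6, coreG6] <;> norm_num
  · refine ⟨⟨[2, 3], [3], ?_⟩, [3, 2], [7], ?_⟩ <;>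
      simp [TPath, G6, coreG6] <;> norm_num
  · refine ⟨⟨[4, 3], [6], ?_⟩, [3, 4], [6], ?_⟩ <;>
      simp [TPath, G6, coreG6]
  · refine ⟨⟨[5, 1, 4, 3], [4, 5, 6], ?_⟩, [3, 2, 1, 5], [7, 8, 11], ?_⟩ <;>
      simp [TPath, G6, coreG6] <;> norm_num

theorem G6_deleteEdge_1_2_not_temporallyConnected :
    ¬ (G6.deleteEdge 1 2).TemporallyConnected := fun h =>
  not_reach_of_arrival ![⊤, 10, 0, 3, 6, 11] (by decide +kernel) (by decide +kernel)
    (by decide +kernel) (by decide +kernel) (h 2 0 (by decide))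

theorem G6_deleteEdge_2_3_not_temporallyConnected :
    ¬ (G6.deleteEdge 2 3).TemporallyConnected := fun h =>
  not_reach_of_arrival ![⊤, 10, ⊤, 0, 6, 11] (by decide +kernel) (by decide +kernel)
    (by decide +kernel) (by decide +kernel) (h 3 0 (by decide))

theorem G6_deleteEdge_3_4_not_temporallyConnected :
    ¬ (G6.deleteEdge 3 4).TemporallyConnected := fun h =>
  not_reach_of_arrival ![9, 5, 8, ⊤, 0, 11] (by decide +kernel) (by decide +kernel)
    (by decide +kernel) (by decide +kernel) (h 4 3 (by decide))

theorem G6_deleteEdge_4_1_not_temporallyConnected :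
    ¬ (G6.deleteEdge 4 1).TemporallyConnected := fun h =>
  not_reach_of_arrival ![9, 4, 8, ⊤, ⊤, 0] (by decide +kernel) (by decide +kernel)
    (by decide +kernel) (by decide +kernel) (h 5 4 (by decide))

/-- `G6` is temporally connected, every pair of distinct vertices of `G6`
is joined by a bi-path, and `d` (vertex `3`) is a pivot; yet `G6` admits no temporal
spanning tree. -/
theorem stmt1 :
    G6.TemporallyConnected ∧
    G6.BiConnected ∧
    G6.IsPivot 3 ∧
    ¬ ∃ H : TemporalGraph (Fin 6), H.IsSpanningTree G6 := by
  refine ⟨G6_biConnected.temporallyConnected, G6_biConnected, G6_isPivot, ?_⟩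
  rintro ⟨H, ⟨hHG, hH⟩, hT⟩
  have key : ∀ a b, ¬ (G6.deleteEdge a b).TemporallyConnected → H.footprint.Adj a b := by
    intro a b hab
    by_contra hadj
    exact hab fun u v huv => (hH u v huv).mono (hHG.deleteEdge hadj)
  exact not_isAcyclic_of_square (by decide) (by decide)
    (key 1 2 G6_deleteEdge_1_2_not_temporallyConnected)
    (key 2 3 G6_deleteEdge_2_3_not_temporallyConnected)
    (key 3 4 G6_deleteEdge_3_4_not_temporallyConnected)
    (key 4 1 G6_deleteEdge_4_1_not_temporallyConnected) hT.isAcyclic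

end TemporalPaper
end

section
/- If a simple temporal graph is bidirectionally temporally connected in the strict setting (every pair of distinct vertices is joined by a bi-path whose two temporal paths are strict), then its footprint is a complete graph. -/
namespace TemporalPaper

open TemporalGraph

/-- Three consecutive vertices of a temporal walk carry two related consecutive times. -/
theorem TemporalGraph.IsTJ.exists_rel_of_append {V : Type*} {G : TemporalGraph V}
    {r : ℚ → ℚ → Prop} {l m : List V} {a b c : V} {ts : List ℚ}
    (h : G.IsTJ r (l ++ a :: b :: c :: m) ts) :
    ∃ s ∈ G.label a b, ∃ t ∈ G.label b c, r s t := by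
  induction l generalizing ts with
  | nil =>
    cases h with
    | cons hs h' hr =>
      cases h' with
      | cons ht _ _ => exact ⟨_, hs, _, ht, hr _ rfl⟩
  | cons x l ih =>
    generalize hq : l ++ a :: b :: c :: m = q at h ih
    rw [List.cons_append, hq] at h
    cases h with
    | single => simp at hq
    | cons _ h' _ => exact ih h'

/-- if a simple temporal graph is bidirectionally temporally connected in
the strict setting (every pair of distinct vertices is joined by a bi-path whose two
temporal paths are strict), then its footprint is a complete graph. -/
theorem stmt5 {V : Type*} [Fintype V] (G : TemporalGraph V) (hs : G.Simple)
    (h : G.BiConnectedRel (· < ·)) :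
    ∀ u v : V, u ≠ v → G.footprint.Adj u v := by
  intro u v huv
  obtain ⟨p, ts₁, ts₂, ⟨h₁, -, hu, hv⟩, h₂, -, -, -⟩ := h u v huv
  match p, h₁, h₂, hu, hv with
  | [], _, _, hu, _ => simp at hu
  | [a], _, _, hu, hv =>
    simp only [List.head?_cons, List.getLast?_singleton, Option.some.injEq] at hu hv
    exact absurd (hu.symm.trans hv) huv
  | [a, b], .cons ht _ _, _, hu, hv =>
    simp only [List.head?_cons, List.getLast?_cons_cons, List.getLast?_singleton,
      Option.some.injEq] at hu hv
    subst hu hv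
    exact ⟨_, ht⟩
  | a :: b :: c :: m, h₁, h₂, _, _ =>
    obtain ⟨s, hsab, t, htbc, hst⟩ := IsTJ.exists_rel_of_append (l := []) h₁
    rw [show (a :: b :: c :: m).reverse = m.reverse ++ c :: b :: a :: [] by simp] at h₂
    obtain ⟨t', htcb, s', hsba, hts⟩ := IsTJ.exists_rel_of_append h₂
    rw [G.symm] at htcb hsba
    have hs_eq := Finset.card_le_one.mp (hs a b) s hsab s' hsba
    have ht_eq := Finset.card_le_one.mp (hs b c) t htbc t' htcb
    subst hs_eq ht_eq
    exact absurd hst (lt_asymm hts)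

end TemporalPaper
end

section
/- A simple temporal graph admits a temporal spanning tree in the non-strict setting if and only if there exists a time t such that the snapshot of G at time t contains a spanning tree of the footprint (equivalently, the snapshot at time t is connected and spans all of V). -/
namespace TemporalPaper

open TemporalGraph

namespace TemporalGraph

variable {V : Type*}

theorem IsTJ.exists_walk {G : TemporalGraph V} {r : ℚ → ℚ → Prop} {p : List V} {ts : List ℚ}
    (h : G.IsTJ r p ts) {u v : V} (hu : p.head? = some u) (hv : p.getLast? = some v) :
    ∃ w : G.footprint.Walk u v, w.support = p := by
  induction h generalizing u with
  | single x =>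
    obtain rfl : x = u := by simpa using hu
    obtain rfl : x = v := by simpa using hv
    exact ⟨.nil, rfl⟩
  | @cons x y p t ts ht _ _ ih =>
    obtain rfl : x = u := by simpa using hu
    obtain ⟨w, hw⟩ := ih (u := y) rfl (by simpa using hv)
    have hxy : G.footprint.Adj x y := ⟨t, ht⟩
    exact ⟨.cons hxy w, by simp [hw]⟩

/-- In a simple temporally connected graph with acyclic footprint, the two labels along a path
with two edges are in increasing order. -/
theorem TemporallyConnected.label_le {H : TemporalGraph V} (hc : H.TemporallyConnected)
    (hs : H.Simple) (ha : H.footprint.IsAcyclic) {u v w : V} (huw : u ≠ w) {s t : ℚ}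
    (h₁ : s ∈ H.label u v) (h₂ : t ∈ H.label v w) : s ≤ t := by
  obtain ⟨p, ts, hp, hnd, hhead, hlast⟩ := hc u w huw
  obtain ⟨q, rfl⟩ := hp.exists_walk hhead hlast
  have huv : H.footprint.Adj u v := ⟨s, h₁⟩
  have hvw : H.footprint.Adj v w := ⟨t, h₂⟩
  have hq : q = .cons huv (.cons hvw .nil) :=
    congrArg Subtype.val ((ha.subsingleton_path u w).elim ⟨q, .mk' hnd⟩
      ⟨.cons huv (.cons hvw .nil), .mk' (by simp [huv.ne, hvw.ne, huw])⟩)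
  subst hq
  rcases hp with _ | ⟨hs', _ | ⟨ht', -, -⟩, hle⟩
  rw [Finset.card_le_one.mp (hs u v) s h₁ _ hs', Finset.card_le_one.mp (hs v w) t h₂ _ ht']
  exact hle _ rfl

theorem TemporallyConnected.label_eq {H : TemporalGraph V} (hc : H.TemporallyConnected)
    (hs : H.Simple) (ha : H.footprint.IsAcyclic) {u x y : V} {s t : ℚ}
    (h₁ : s ∈ H.label u x) (h₂ : t ∈ H.label u y) : s = t := by
  by_cases hxy : x = y
  · subst hxy
    exact Finset.card_le_one.mp (hs u x) s h₁ t h₂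
  · exact le_antisymm (hc.label_le hs ha hxy (H.symm u x ▸ h₁) h₂)
      (hc.label_le hs ha (Ne.symm hxy) (H.symm u y ▸ h₂) h₁)

theorem TemporallyConnected.label_eq_of_walk {H : TemporalGraph V} (hc : H.TemporallyConnected)
    (hs : H.Simple) (ha : H.footprint.IsAcyclic) {u v : V} (w : H.footprint.Walk u v)
    {x y : V} {s t : ℚ} (h₁ : s ∈ H.label u x) (h₂ : t ∈ H.label v y) : s = t := by
  induction w generalizing x s with
  | nil => exact hc.label_eq hs ha h₁ h₂
  | @cons a b c hab _ ih =>
    obtain ⟨r, hr⟩ : (H.label a b).Nonempty := hab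
    exact (hc.label_eq hs ha h₁ hr).trans (ih (H.symm a b ▸ hr) h₂)

theorem IsSubgraph.simple {H G : TemporalGraph V} (h : H.IsSubgraph G) (hs : G.Simple) :
    H.Simple :=
  fun u v => (Finset.card_le_card (h u v)).trans (hs u v)

open Classical in
/-- The temporal graph in which every edge of `T` has the single label `t`. -/
noncomputable def ofSimpleGraph (T : SimpleGraph V) (t : ℚ) : TemporalGraph V where
  label u v := if T.Adj u v then {t} else ∅
  symm u v := by simp only [T.adj_comm]
  loopless v := by simp

theorem mem_label_ofSimpleGraph {T : SimpleGraph V} {t s : ℚ} {u v : V} :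
    s ∈ (ofSimpleGraph T t).label u v ↔ T.Adj u v ∧ s = t := by
  by_cases h : T.Adj u v <;> simp [ofSimpleGraph, h]

theorem footprint_ofSimpleGraph (T : SimpleGraph V) (t : ℚ) :
    (ofSimpleGraph T t).footprint = T := by
  ext u v
  simp [footprint, Finset.Nonempty, mem_label_ofSimpleGraph]

theorem isTJ_ofSimpleGraph {T : SimpleGraph V} (t : ℚ) {u v : V} (w : T.Walk u v) :
    (ofSimpleGraph T t).IsTJ (· ≤ ·) w.support (List.replicate w.length t) := by
  induction w with
  | nil => exact .single _
  | @cons a b c hab w ih =>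
    rw [SimpleGraph.Walk.support_cons, SimpleGraph.Walk.length_cons, List.replicate_succ]
    rw [← w.cons_tail_support] at ih ⊢
    refine .cons (mem_label_ofSimpleGraph.mpr ⟨hab, rfl⟩) ih fun t' ht' => ?_
    exact (List.eq_of_mem_replicate (List.mem_of_mem_head? ht')).ge

theorem temporallyConnected_ofSimpleGraph {T : SimpleGraph V} (hT : T.Connected) (t : ℚ) :
    (ofSimpleGraph T t).TemporallyConnected := by
  intro u v _
  obtain ⟨w, hw⟩ := (hT.preconnected u v).exists_isPath
  refine ⟨w.support, _, isTJ_ofSimpleGraph t w, hw.support_nodup, ?_, ?_⟩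
  · rw [List.head?_eq_some_head w.support_ne_nil, w.head_support]
  · rw [List.getLast?_eq_some_getLast w.support_ne_nil, w.getLast_support]

end TemporalGraph

/-- a simple temporal graph admits a temporal spanning tree (non-strict
setting) iff some snapshot is connected and spans all of `V` (equivalently, contains a
spanning tree of the footprint). -/
theorem stmt8 {V : Type*} [Fintype V] (G : TemporalGraph V) (hs : G.Simple) :
    (∃ H : TemporalGraph V, H.IsSpanningTree G) ↔
    (∃ t : ℚ, (G.snapshot t).Connected) := by
  constructor
  · rintro ⟨H, ⟨hsub, hc⟩, htree⟩
    have hH := hsub.simple hs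
    suffices ∃ t, H.footprint ≤ G.snapshot t from
      this.imp fun t ht => htree.connected.mono ht
    by_cases he : ∃ u v, H.footprint.Adj u v
    · obtain ⟨u, v, t, ht⟩ := he
      refine ⟨t, fun x y ⟨s, hxy⟩ => hsub x y ?_⟩
      obtain ⟨w⟩ := htree.connected.preconnected u x
      rwa [hc.label_eq_of_walk hH htree.isAcyclic w ht hxy]
    · exact ⟨0, fun x y hxy => (he ⟨x, y, hxy⟩).elim⟩
  · rintro ⟨t, ht⟩
    obtain ⟨T, hle, hT⟩ := ht.exists_isTree_le
    refine ⟨ofSimpleGraph T t, ⟨fun u v s hmem => ?_,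
      temporallyConnected_ofSimpleGraph hT.connected t⟩, ?_⟩
    · obtain ⟨hadj, rfl⟩ := mem_label_ofSimpleGraph.mp hmem
      exact hle hadj
    · rwa [footprint_ofSimpleGraph]

end TemporalPaper
end

section
/- Let G=(V,E,λ) be a happy temporal graph whose footprint is the complete graph on V. Then G is bidirectionally temporally connected, but for every edge e ∈ E, the temporal graph obtained from G by deleting e is not bidirectionally temporally connected. -/
namespace TemporalPaper

open TemporalGraph

namespace TemporalGraph

variable {V : Type*} {G H : TemporalGraph V} {r : ℚ → ℚ → Prop}

theorem IsTJ.rel_of_append {p : List V} {x y z : V} {ts : List ℚ}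
    (h : G.IsTJ r (p ++ [x, y, z]) ts) :
    ∃ s ∈ G.label x y, ∃ t ∈ G.label y z, r s t := by
  induction p generalizing ts with
  | nil =>
    cases h with
    | cons hs h hr =>
      cases h with
      | cons ht _ _ => exact ⟨_, hs, _, ht, hr _ rfl⟩
  | cons a p ih =>
    rw [List.cons_append] at h
    generalize hq : p ++ [x, y, z] = q at h ih
    cases h with
    | single => simp at hq
    | cons _ h _ => exact ih h

theorem Happy.of_isSubgraph (hG : G.Happy) (h : H.IsSubgraph G) : H.Happy :=
  ⟨fun u v => (Finset.card_le_card (h u v)).trans (hG.1 u v),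
    fun u v w hvw => (hG.2 u v w hvw).mono (h u v) (h u w)⟩

theorem deleteEdge_isSubgraph [DecidableEq V] (G : TemporalGraph V) (a b : V) :
    (G.deleteEdge a b).IsSubgraph G := by
  intro u v
  simp only [deleteEdge]
  split_ifs <;> simp

theorem biPath_of_mem_label (r : ℚ → ℚ → Prop) {u v : V} {t : ℚ} (huv : u ≠ v)
    (ht : t ∈ G.label u v) : G.BiPath r u v [u, v] [t] [t] :=
  ⟨⟨.cons ht (.single v) (by simp), by simpa using huv, rfl, rfl⟩,
    .cons (G.symm u v ▸ ht) (.single u) (by simp), by simpa using huv.symm, rfl, rfl⟩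

/-- In a happy temporal graph, the endpoints of a nontrivial bi-path are adjacent: the labels
along a bi-path through three consecutive vertices would have to increase in both directions. -/
theorem Happy.adj_of_biPath (hG : G.Happy) {u v : V} (huv : u ≠ v) {p : List V}
    {ts₁ ts₂ : List ℚ} (h : G.BiPath (· ≤ ·) u v p ts₁ ts₂) : G.footprint.Adj u v := by
  obtain ⟨⟨h₁, hnd, hhead, hlast⟩, h₂, -⟩ := h
  match p with
  | [] => simp at hhead
  | [a] => simp_all
  | [a, b] =>
    obtain rfl : a = u := by simpa using hhead
    obtain rfl : b = v := by simpa using hlast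
    cases h₁ with
    | cons ht _ _ => exact ⟨_, ht⟩
  | a :: x :: y :: q =>
    have hay : a ≠ y := by rintro rfl; simp at hnd
    have h₂' : G.IsTJ (· ≤ ·) (q.reverse ++ [y, x, a]) ts₂ := by simpa using h₂
    obtain ⟨t₃, h₃, t₄, h₄, h₃₄⟩ := h₂'.rel_of_append
    cases h₁ with
    | cons hs h₁ hr =>
      cases h₁ with
      | @cons _ _ _ t₂ _ ht _ _ =>
        have hle := hr t₂ rfl
        rw [G.symm] at hs h₃
        obtain rfl := Finset.card_le_one.mp (hG.1 x a) _ hs _ h₄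
        obtain rfl := Finset.card_le_one.mp (hG.1 x y) _ ht _ h₃
        obtain rfl := le_antisymm hle h₃₄
        exact absurd ht (Finset.disjoint_left.mp (hG.2 x a y hay) hs)

end TemporalGraph

/-- Lemma: happy cliques: let `G` be a happy temporal graph whose
footprint is the complete graph on `V`. Then `G` is bidirectionally temporally
connected, but deleting any edge of `G` destroys bidirectional temporal connectivity. -/
theorem stmt9 {V : Type*} [Fintype V] [DecidableEq V] (G : TemporalGraph V)
    (hG : G.Happy) (hc : ∀ u v : V, u ≠ v → G.footprint.Adj u v) :
    G.BiConnected ∧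
    ∀ a b : V, G.footprint.Adj a b → ¬ (G.deleteEdge a b).BiConnected := by
  refine ⟨fun u v huv => ?_, fun a b hab h => ?_⟩
  · obtain ⟨t, ht⟩ := hc u v huv
    exact ⟨_, _, _, biPath_of_mem_label _ huv ht⟩
  · obtain ⟨p, ts₁, ts₂, hp⟩ := h a b hab.ne
    have hadj := (hG.of_isSubgraph (G.deleteEdge_isSubgraph a b)).adj_of_biPath hab.ne hp
    simp [footprint, deleteEdge] at hadj

end TemporalPaper
end

section
/- If a temporal graph G on n vertices has a pivot, then G admits a temporal spanner whose footprint has at most 2(n−1) edges. -/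
namespace TemporalPaper

open TemporalGraph

/-- `MonoWalk L x t k v s`: in the family of contacts `L`, there is a walk with `k + 1` contacts
from `v` to `x` along which the times are nondecreasing, the first one being `s` and the last one
being at most `t`. -/
inductive MonoWalk {V T : Type*} [LE T] (L : V → V → T → Prop) (x : V) (t : T) :
    ℕ → V → T → Prop
  | last {v : V} {s : T} : L v x s → s ≤ t → MonoWalk L x t 0 v s
  | step {k : ℕ} {v w : V} {s s' : T} :
      L v w s → s ≤ s' → MonoWalk L x t k w s' → MonoWalk L x t (k + 1) v s

namespace MonoWalk

variable {V T : Type*} {x : V}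

theorem le_bound [Preorder T] {L : V → V → T → Prop} {t : T} {k : ℕ} {v : V} {s : T}
    (h : MonoWalk L x t k v s) : s ≤ t := by
  induction h with
  | last _ h => exact h
  | step _ h _ ih => exact h.trans ih

theorem exists_label [LE T] {L : V → V → T → Prop} {t : T} {k : ℕ} {v : V} {s : T}
    (h : MonoWalk L x t k v s) : ∃ w, L v w s := by
  cases h with
  | last h _ => exact ⟨_, h⟩
  | step h _ _ => exact ⟨_, h⟩

theorem mono [LE T] {L L' : V → V → T → Prop} (hL : ∀ a b s, L a b s → L' a b s) {t : T} {k : ℕ}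
    {v : V} {s : T} (h : MonoWalk L x t k v s) : MonoWalk L' x t k v s := by
  induction h with
  | last h h' => exact .last (hL _ _ _ h) h'
  | step h h' _ ih => exact .step (hL _ _ _ h) h' ih

/-- A walk from `v` of latest departure and, among those, with fewest contacts. -/
theorem exists_optimal [Finite V] [LinearOrder T] {L : V → V → T → Prop}
    (hfin : ∀ v w, {s | L v w s}.Finite) {t : T} {v : V} (h : ∃ k s, MonoWalk L x t k v s) :
    ∃ k s, MonoWalk L x t k v s ∧ (∀ k' s', MonoWalk L x t k' v s' → s' ≤ s) ∧
      ∀ k', MonoWalk L x t k' v s → k ≤ k' := by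
  classical
  have hA : {s | ∃ k, MonoWalk L x t k v s}.Finite :=
    (Set.finite_iUnion (hfin v)).subset fun s ⟨_, hk⟩ => Set.mem_iUnion.2 hk.exists_label
  obtain ⟨k, s, hks⟩ := h
  obtain ⟨m, hm, hmax⟩ := Set.exists_max_image _ id hA ⟨s, k, hks⟩
  have hm : ∃ k, MonoWalk L x t k v m := hm
  exact ⟨Nat.find hm, m, Nat.find_spec hm, fun k' s' h' => hmax s' ⟨k', h'⟩,
    fun k' h' => Nat.find_min' hm h'⟩

/-- If every vertex other than `x` has a monotone walk to `x`, then such walks can be found in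
an in-tree rooted at `x`, given by a parent function. -/
theorem exists_parent [Finite V] [LinearOrder T] {L : V → V → T → Prop}
    (hfin : ∀ v w, {s | L v w s}.Finite) {t : T} (h : ∀ v ≠ x, ∃ k s, MonoWalk L x t k v s) :
    ∃ par : V → V, ∀ v ≠ x, ∃ k s,
      MonoWalk (fun a b s => L a b s ∧ a ≠ x ∧ b = par a) x t k v s := by
  have hopt : ∀ v, ∃ k s, v ≠ x → MonoWalk L x t k v s ∧
      (∀ k' s', MonoWalk L x t k' v s' → s' ≤ s) ∧ ∀ k', MonoWalk L x t k' v s → k ≤ k' := by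
    intro v
    by_cases hv : v = x
    · exact ⟨0, t, fun h => absurd hv h⟩
    · obtain ⟨k, s, hks⟩ := exists_optimal hfin (h v hv)
      exact ⟨k, s, fun _ => hks⟩
  choose K D hKD using hopt
  have hpar : ∀ v, ∃ w, v ≠ x → L v w (D v) ∧
      (w ≠ x → D v < D w ∨ D v = D w ∧ K w < K v) := by
    intro v
    by_cases hv : v = x
    · exact ⟨x, fun h => absurd hv h⟩
    obtain ⟨hW, -, -⟩ := hKD v hv
    generalize hk : K v = k at hW
    generalize hd : D v = d at hW
    cases hW with
    | last hl _ => exact ⟨x, fun _ => ⟨hl, fun h => absurd rfl h⟩⟩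
    | @step k _ w _ s' hl hs hw =>
      refine ⟨w, fun _ => ⟨hl, fun hwx => ?_⟩⟩
      obtain ⟨-, hmax, hmin⟩ := hKD w hwx
      have hle : s' ≤ D w := hmax _ _ hw
      rcases (hs.trans hle).lt_or_eq with h1 | h1
      · exact .inl h1
      · have : s' = D w := le_antisymm hle (h1 ▸ hs)
        exact .inr ⟨h1, Nat.lt_succ_of_le (hmin _ (this ▸ hw))⟩
  choose par hpar using hpar
  refine ⟨par, fun v hv => ?_⟩
  let r : V → V → Prop := fun w v => D v < D w ∨ D v = D w ∧ K w < K v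
  have : IsTrans V r := ⟨fun a b c h₁ h₂ => by
    rcases h₁ with h₁ | ⟨h₁, h₁'⟩ <;> rcases h₂ with h₂ | ⟨h₂, h₂'⟩
    · exact .inl (h₂.trans h₁)
    · exact .inl (h₂ ▸ h₁)
    · exact .inl (h₁ ▸ h₂)
    · exact .inr ⟨h₂.trans h₁, h₁'.trans h₂'⟩⟩
  have : Std.Irrefl r := ⟨fun a h => by
    rcases h with h | ⟨-, h⟩
    · exact lt_irrefl _ h
    · exact lt_irrefl _ h⟩
  have hwf : WellFounded r := Finite.wellFounded_of_trans_of_irrefl r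
  suffices ∃ k, MonoWalk (fun a b s => L a b s ∧ a ≠ x ∧ b = par a) x t k v (D v) from
    this.elim fun k hk => ⟨k, _, hk⟩
  induction v using hwf.induction with
  | _ v ih =>
    obtain ⟨hl, hlt⟩ := hpar v hv
    by_cases hx : par v = x
    · exact ⟨0, .last ⟨hx ▸ hl, hv, hx.symm⟩ (hKD v hv).1.le_bound⟩
    · obtain ⟨k, hk⟩ := ih (par v) (hlt hx) hx
      refine ⟨k + 1, .step ⟨hl, hv, rfl⟩ ?_ hk⟩
      rcases hlt hx with h | h
      · exact h.le
      · exact h.1.le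

end MonoWalk

namespace TemporalGraph

variable {V : Type*} {G : TemporalGraph V}

theorem IsTJ.exists_monoWalk {p : List V} {ts : List ℚ} (h : G.IsTJ (· ≤ ·) p ts) {u x : V} {t : ℚ}
    (hu : p.head? = some u) (hx : p.getLast? = some x) (ht : ∀ t' ∈ ts.getLast?, t' ≤ t)
    (hux : ts ≠ []) :
    ∃ k, ∃ s ∈ ts.head?, MonoWalk (fun a b s => s ∈ G.label a b) x t k u s := by
  induction h generalizing u with
  | single v => exact absurd rfl hux
  | @cons a b p s ts hs hp hle ih =>
    obtain rfl : a = u := by simpa using hu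
    by_cases hts : ts = []
    · subst hts
      cases hp
      obtain rfl : b = x := by simpa using hx
      exact ⟨0, s, rfl, .last hs (ht s rfl)⟩
    · obtain ⟨k, s', hs', hk⟩ := ih rfl (by simpa [List.getLast?_cons_cons] using hx)
        (by
          obtain ⟨c, l, rfl⟩ := List.exists_cons_of_ne_nil hts
          simpa [List.getLast?_cons_cons] using ht) hts
      exact ⟨k + 1, s, rfl, .step hs (hle s' hs') hk⟩

theorem ArrivesBy.exists_monoWalk {u x : V} {t : ℚ} (h : G.ArrivesBy u x t) (hux : u ≠ x) :
    ∃ k s, MonoWalk (fun a b s => s ∈ G.label a b) x t k u s := by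
  obtain ⟨p, ts, ⟨hp, -, hu, hx⟩, ht⟩ := h
  obtain ⟨k, s, -, hk⟩ := hp.exists_monoWalk hu hx ht (by
    rintro rfl
    cases hp
    simp_all)
  exact ⟨k, s, hk⟩

open OrderDual in
/-- Extending a reversed-time walk from `v` back to `x` along a temporal walk leaving `v`. -/
theorem IsTJ.exists_monoWalk_dual {p : List V} {ts : List ℚ} (h : G.IsTJ (· ≤ ·) p ts) {u v x : V}
    {t : ℚ} (hv : p.head? = some v) (hu : p.getLast? = some u)
    (hstart : (v = x ∧ ∀ t' ∈ ts.head?, t ≤ t') ∨ ∃ k s, MonoWalk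
      (fun a b (s : ℚᵒᵈ) => ofDual s ∈ G.label a b) x (toDual t) k v (toDual s) ∧
        ∀ t' ∈ ts.head?, s ≤ t') :
    u = x ∨ ∃ k s, MonoWalk
      (fun a b (s : ℚᵒᵈ) => ofDual s ∈ G.label a b) x (toDual t) k u s := by
  induction h generalizing v with
  | single w =>
    obtain rfl : w = v := by simpa using hv
    obtain rfl : w = u := by simpa using hu
    rcases hstart with ⟨h, -⟩ | ⟨k, s, h, -⟩
    · exact .inl h
    · exact .inr ⟨k, _, h⟩
  | @cons a b p s ts hs hp hle ih =>
    obtain rfl : a = v := by simpa using hv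
    rw [G.symm] at hs
    refine ih rfl (by simpa [List.getLast?_cons_cons] using hu) (.inr ?_)
    rcases hstart with ⟨rfl, h⟩ | ⟨k, s', hk, h⟩
    · exact ⟨0, s, .last hs (h s rfl), hle⟩
    · exact ⟨k + 1, s, .step hs (h s rfl) hk, hle⟩

open OrderDual in
theorem DepartsAfter.exists_monoWalk {u x : V} {t : ℚ} (h : G.DepartsAfter x u t) (hux : u ≠ x) :
    ∃ k s, MonoWalk (fun a b (s : ℚᵒᵈ) => ofDual s ∈ G.label a b) x (toDual t) k u s := by
  obtain ⟨p, ts, ⟨hp, -, hx, hu⟩, ht⟩ := h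
  exact (hp.exists_monoWalk_dual hx hu (.inl ⟨rfl, ht⟩)).resolve_left hux

theorem DepartsAfter.refl (v : V) (s : ℚ) : G.DepartsAfter v v s :=
  ⟨[v], [], ⟨.single v, by simp, rfl, rfl⟩, by simp⟩

theorem IsTJ.departsAfter_of_mem {p : List V} {ts : List ℚ} (h : G.IsTJ (· ≤ ·) p ts) {u v : V}
    {s : ℚ} (hp : p.Nodup) (hv : p.getLast? = some v) (hs : ∀ t' ∈ ts.head?, s ≤ t')
    (hu : u ∈ p) : G.DepartsAfter u v s := by
  induction h with
  | single w =>
    obtain rfl : u = w := by simpa using hu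
    exact ⟨[u], [], ⟨.single u, hp, rfl, hv⟩, hs⟩
  | @cons a b p a' ts hl hq hle ih =>
    rcases List.mem_cons.1 hu with rfl | hu
    · exact ⟨_, _, ⟨.cons hl hq hle, hp, rfl, hv⟩, hs⟩
    · exact ih (List.nodup_cons.1 hp).2 (by simpa [List.getLast?_cons_cons] using hv)
        (fun t' ht' => (hs a' rfl).trans (hle t' ht')) hu

theorem DepartsAfter.step {u w v : V} {s a : ℚ} (hl : a ∈ G.label u w) (hsa : s ≤ a)
    (h : G.DepartsAfter w v a) : G.DepartsAfter u v s := by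
  obtain ⟨p, ts, ⟨hp, hn, hw, hv⟩, ht⟩ := h
  by_cases hu : u ∈ p
  · exact hp.departsAfter_of_mem hn hv (fun t' ht' => hsa.trans (ht t' ht')) hu
  · obtain ⟨q, rfl⟩ : ∃ q, p = w :: q := List.head?_eq_some_iff.1 hw
    exact ⟨u :: w :: q, a :: ts, ⟨.cons hl hp ht, List.nodup_cons.2 ⟨hu, hn⟩, rfl,
      by simpa [List.getLast?_cons_cons] using hv⟩, by simpa using hsa⟩

theorem _root_.TemporalPaper.MonoWalk.departsAfter {x : V} {t : ℚ} {k : ℕ} {u : V} {s : ℚ}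
    (h : MonoWalk (fun a b s => s ∈ G.label a b) x t k u s) {v : V} (hv : G.DepartsAfter x v t) :
    G.DepartsAfter u v s := by
  have weaken {w : V} {s s' : ℚ} (hs : s ≤ s') (h : G.DepartsAfter w v s') :
      G.DepartsAfter w v s := by
    obtain ⟨p, ts, hp, ht⟩ := h
    exact ⟨p, ts, hp, fun t' ht' => hs.trans (ht t' ht')⟩
  induction h with
  | last hl hs => exact .step hl le_rfl (weaken hs hv)
  | step hl hs _ ih => exact .step hl le_rfl (weaken hs ih)

open OrderDual in
theorem _root_.TemporalPaper.MonoWalk.departsAfter_dual {x : V} {t : ℚᵒᵈ} {k : ℕ} {u : V}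
    {s : ℚᵒᵈ} (h : MonoWalk (fun a b (s : ℚᵒᵈ) => ofDual s ∈ G.label a b) x t k u s) {v : V}
    (hv : G.DepartsAfter u v (ofDual s)) : G.DepartsAfter x v (ofDual t) := by
  induction h with
  | last hl hs =>
    rw [G.symm] at hl
    exact .step hl hs hv
  | step hl hs _ ih =>
    rw [G.symm] at hl
    exact ih (.step hl hs hv)

open Classical in
/-- The temporal subgraph keeping exactly the labels of the pairs in `E`. -/
noncomputable def restrictEdges (G : TemporalGraph V) (E : Set (Sym2 V)) : TemporalGraph V where
  label a b := if s(a, b) ∈ E then G.label a b else ∅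
  symm a b := by rw [Sym2.eq_swap, G.symm]
  loopless v := by simp [G.loopless]

theorem restrictEdges_isSubgraph (G : TemporalGraph V) (E : Set (Sym2 V)) :
    (G.restrictEdges E).IsSubgraph G := by
  intro a b
  unfold restrictEdges
  dsimp only
  split_ifs <;> simp

theorem mem_restrictEdges_label {E : Set (Sym2 V)} {a b : V} {s : ℚ} :
    s ∈ (G.restrictEdges E).label a b ↔ s(a, b) ∈ E ∧ s ∈ G.label a b := by
  unfold restrictEdges
  dsimp only
  split_ifs with h <;> simp [h]

theorem edgeSet_footprint_restrictEdges_subset (E : Set (Sym2 V)) :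
    (G.restrictEdges E).footprint.edgeSet ⊆ E := by
  intro e
  induction e with
  | _ a b =>
    rintro ⟨s, hs⟩
    exact (mem_restrictEdges_label.1 hs).1

end TemporalGraph

/-- if a temporal graph `G` on `n` vertices has a pivot, then `G` admits
a temporal spanner whose footprint has at most `2(n-1)` edges. -/
theorem stmt11 {V : Type*} [Fintype V] (G : TemporalGraph V) (x : V)
    (hx : G.IsPivot x) :
    ∃ H : TemporalGraph V, H.IsSpanner G ∧
      H.footprint.edgeSet.ncard ≤ 2 * (Fintype.card V - 1) := by
  obtain ⟨t, ht⟩ := hx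
  obtain ⟨f, hf⟩ := MonoWalk.exists_parent (L := fun a b s => s ∈ G.label a b)
    (fun v w => (G.label v w).finite_toSet) fun v hv => (ht v hv).1.exists_monoWalk hv
  obtain ⟨g, hg⟩ := MonoWalk.exists_parent
    (L := fun a b (s : ℚᵒᵈ) => OrderDual.ofDual s ∈ G.label a b)
    (fun v w => (G.label v w).finite_toSet) fun v hv => (ht v hv).2.exists_monoWalk hv
  set E : Set (Sym2 V) := (fun v => s(v, f v)) '' {x}ᶜ ∪ (fun v => s(v, g v)) '' {x}ᶜ with hE
  refine ⟨G.restrictEdges E, ⟨G.restrictEdges_isSubgraph E, fun u v _ => ?_⟩, ?_⟩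
  · have hout : (G.restrictEdges E).DepartsAfter x v t := by
      by_cases hv : v = x
      · exact hv ▸ .refl _ _
      · obtain ⟨k, s, hk⟩ := hg v hv
        refine (hk.mono fun a b s h => mem_restrictEdges_label.2 ⟨.inr ⟨a, h.2.1, ?_⟩, h.1⟩
          ).departsAfter_dual (.refl v _)
        rw [h.2.2]
    suffices ∃ s, (G.restrictEdges E).DepartsAfter u v s by
      obtain ⟨s, p, ts, hp, -⟩ := this
      exact ⟨p, ts, hp⟩
    by_cases hu : u = x
    · exact ⟨t, hu ▸ hout⟩
    · obtain ⟨k, s, hk⟩ := hf u hu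
      refine ⟨s, (hk.mono fun a b s h => mem_restrictEdges_label.2 ⟨.inl ⟨a, h.2.1, ?_⟩, h.1⟩
        ).departsAfter hout⟩
      rw [h.2.2]
  · have hcard : ({x}ᶜ : Set V).ncard = Fintype.card V - 1 := by
      rw [Set.ncard_compl, Set.ncard_singleton, Nat.card_eq_fintype_card]
    calc _ ≤ E.ncard :=
          Set.ncard_le_ncard (edgeSet_footprint_restrictEdges_subset E) (Set.toFinite _)
      _ ≤ _ + _ := Set.ncard_union_le _ _
      _ ≤ ({x}ᶜ : Set V).ncard + ({x}ᶜ : Set V).ncard :=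
          add_le_add (Set.ncard_image_le (Set.toFinite _)) (Set.ncard_image_le (Set.toFinite _))
      _ = 2 * (Fintype.card V - 1) := by rw [hcard, two_mul]

end TemporalPaper
end
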